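/- Let A be a (possibly unbounded) self-adjoint operator on a separable complex Hilbert space H, V a self-adjoint operator in the Schatten 3-class B_3(H), and A_τ = A + τV for τ ∈ [0,1]. Then for all real ν and τ, ‖e^{iνA_τ} − e^{iνA}‖₃ ≤ |ν τ| ‖V‖₃, where ‖·‖₃ is the Schatten 3-norm; in particular, for real t, β, ν with 0 ≤ ν ≤ β ≤ t, the operator e^{iνA_τ} V e^{i(β−ν)A_τ} V e^{i(t−β)A_τ} − e^{iνA} V e^{i(β−ν)A} V e^{i(t−β)A} is trace class with trace norm at most |τ| ‖V‖₃³ (|ν| + |β−ν| + |t−β|). -/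

import Mathlib

open MeasureTheory
noncomputable section

local notation "⟪" x ", " y "⟫" => @inner ℂ _ _ x y

variable {H : Type} [NormedAddCommGroup H] [InnerProductSpace ℂ H] [CompleteSpace H]

/-- The absolute value `|T| = (T^*T)^{1/2}`. -/
def absCLM (T : H →L[ℂ] H) : H →L[ℂ] H := CFC.sqrt (star T * T)

/-- `T` is trace class. -/
def IsTraceClass (e : HilbertBasis ℕ ℂ H) (T : H →L[ℂ] H) : Prop :=
  Summable fun n => (⟪e n, absCLM T (e n)⟫).re

/-- The trace norm `‖T‖₁ = Tr |T|`. -/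
def traceNorm (e : HilbertBasis ℕ ℂ H) (T : H →L[ℂ] H) : ℝ :=
  ∑' n, (⟪e n, absCLM T (e n)⟫).re

/-- `T` belongs to the Schatten 3-class: `Tr |T|³ < ∞`. -/
def IsSchatten3 (e : HilbertBasis ℕ ℂ H) (T : H →L[ℂ] H) : Prop :=
  Summable fun n => (⟪e n, (absCLM T ^ 3) (e n)⟫).re

/-- The Schatten 3-norm `‖T‖₃ = (Tr |T|³)^{1/3}`. -/
def schatten3Norm (e : HilbertBasis ℕ ℂ H) (T : H →L[ℂ] H) : ℝ :=
  (∑' n, (⟪e n, (absCLM T ^ 3) (e n)⟫).re) ^ ((3 : ℝ)⁻¹)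


/-! ### Unitary groups and the Duhamel formula -/

set_option linter.unusedSectionVars false

section Groups

variable {T S : ℝ → H →L[ℂ] H}

theorem inner_group_apply_left (h0 : T 0 = 1) (hgrp : ∀ s t, T (s + t) = T s * T t)
    (hiso : ∀ t x, ‖T t x‖ = ‖x‖) (t : ℝ) (x y : H) : ⟪T t x, y⟫ = ⟪x, T (-t) y⟫ := by
  have h1 : T t (T (-t) y) = y := by
    rw [← mul_apply_eq_comp, ← hgrp, add_neg_cancel, h0]; rfl
  have h3 := (LinearMap.norm_map_iff_inner_map_map (T t)).1 (hiso t) x (T (-t) y)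
  rw [h1] at h3
  exact h3

/-- The infinitesimal generator of a unitary group is symmetric and commutes with the group. -/
theorem inner_generator_group (h0 : T 0 = 1) (hgrp : ∀ s t, T (s + t) = T s * T t)
    (hiso : ∀ t x, ‖T t x‖ = ‖x‖) {x y x' y' : H}
    (hx : ∀ t, HasDerivAt (fun s => T s x) (Complex.I • T t x') t)
    (hy : ∀ t, HasDerivAt (fun s => T s y) (Complex.I • T t y') t) (s : ℝ) :
    ⟪x', T s y⟫ = ⟪x, T s y'⟫ := by
  have e1 : HasDerivAt (fun r : ℝ => ⟪T r x, T s y⟫) (⟪Complex.I • x', T s y⟫) 0 := by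
    have := (hx 0).inner ℂ (hasDerivAt_const (0 : ℝ) (T s y))
    simpa only [h0, map_zero, inner_zero_right, zero_add, one_apply_eq_self] using this
  have e2 : HasDerivAt (fun r : ℝ => ⟪x, T (s - r) y⟫) (⟪x, -(Complex.I • T s y')⟫) 0 := by
    have h := (hy (s - 0)).scomp (0 : ℝ) ((hasDerivAt_id (0 : ℝ)).const_sub s)
    have := (hasDerivAt_const (0 : ℝ) x).inner ℂ h
    simpa using this
  have e3 : (fun r : ℝ => ⟪T r x, T s y⟫) = fun r : ℝ => ⟪x, T (s - r) y⟫ := by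
    funext r
    rw [inner_group_apply_left h0 hgrp hiso, ← mul_apply_eq_comp, ← hgrp,
      neg_add_eq_sub]
  rw [e3] at e1
  have := e1.unique e2
  rw [inner_smul_left, inner_neg_right, inner_smul_right, Complex.conj_I, neg_mul, neg_inj] at this
  exact mul_left_cancel₀ Complex.I_ne_zero this

theorem group_mem_domain (h0 : T 0 = 1) (hgrp : ∀ s t, T (s + t) = T s * T t)
    (hiso : ∀ t x, ‖T t x‖ = ‖x‖) {A : H →ₗ.[ℂ] H} (hA : IsSelfAdjoint A)
    (hgen : ∀ (x : A.domain) t, HasDerivAt (fun s => T s (x : H)) (Complex.I • T t (A x)) t)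
    (s : ℝ) (x : A.domain) : ∃ z : A.domain, (z : H) = T s x ∧ A z = T s (A x) := by
  have hw : ∀ y : A.domain, ⟪T s (A x), (y : H)⟫ = ⟪T s (x : H), A y⟫ := by
    intro y
    have h := inner_generator_group h0 hgrp hiso (hgen y) (hgen x) s
    rw [← inner_conj_symm, ← h, inner_conj_symm]
  have hAd : A.adjoint = A := LinearPMap.isSelfAdjoint_def.1 hA
  have hm : T s (x : H) ∈ A.adjoint.domain :=
    LinearPMap.mem_adjoint_domain_of_exists _ ⟨_, hw⟩
  have hv : A.adjoint ⟨T s (x : H), hm⟩ = T s (A x) :=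
    LinearPMap.adjoint_apply_eq hA.dense_domain ⟨T s (x : H), hm⟩ hw
  revert hm
  rw [hAd]
  exact fun hm hv => ⟨⟨_, hm⟩, rfl, hv⟩

/-- Weak form of Duhamel's formula on the domain of the generator. -/
theorem hasDerivAt_inner_duhamel_domain
    (hT0 : T 0 = 1) (hTgrp : ∀ s t, T (s + t) = T s * T t) (hTiso : ∀ t x, ‖T t x‖ = ‖x‖)
    (hS0 : S 0 = 1) (hSgrp : ∀ s t, S (s + t) = S s * S t) (hSiso : ∀ t x, ‖S t x‖ = ‖x‖)
    {A : H →ₗ.[ℂ] H} (hA : IsSelfAdjoint A) {V : H →L[ℂ] H} {τ : ℝ}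
    (hSgen : ∀ (x : A.domain) t, HasDerivAt (fun s => S s (x : H)) (Complex.I • S t (A x)) t)
    (hTgen : ∀ (x : A.domain) t,
      HasDerivAt (fun s => T s (x : H)) (Complex.I • T t (A x + τ • V (x : H))) t)
    (ν : ℝ) (g x : A.domain) (s : ℝ) :
    HasDerivAt (fun s => ⟪T (-s) (g : H), S (ν - s) (x : H)⟫)
      (Complex.I * τ * ⟪T (-s) (g : H), V (S (ν - s) (x : H))⟫) s := by
  obtain ⟨z, hz, hAz⟩ := group_mem_domain hS0 hSgrp hSiso hA hSgen (ν - s) x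
  have d1 := (hTgen g (-s)).scomp s (hasDerivAt_neg s)
  have d2 := (hSgen x (ν - s)).scomp s ((hasDerivAt_id s).const_sub ν)
  have d := d1.inner ℂ d2
  have key : ⟪T (-s) (A g + τ • V (g : H)), (z : H)⟫ = ⟪T (-s) (g : H), A z + τ • V (z : H)⟫ := by
    rw [inner_group_apply_left hT0 hTgrp hTiso, inner_group_apply_left hT0 hTgrp hTiso, neg_neg]
    exact inner_generator_group hT0 hTgrp hTiso (hTgen g) (hTgen z) s
  refine HasDerivAt.congr_deriv d ?_
  simp only [Function.comp_apply, ← hz, ← hAz, neg_smul, one_smul, inner_neg_right,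
    inner_neg_left, inner_smul_left, inner_smul_right, key, Complex.conj_I, inner_add_right]
  rw [← Complex.coe_smul, inner_smul_right]
  ring

theorem hasDerivAt_inner_duhamel
    (hT0 : T 0 = 1) (hTgrp : ∀ s t, T (s + t) = T s * T t) (hTiso : ∀ t x, ‖T t x‖ = ‖x‖)
    (hS0 : S 0 = 1) (hSgrp : ∀ s t, S (s + t) = S s * S t) (hSiso : ∀ t x, ‖S t x‖ = ‖x‖)
    {A : H →ₗ.[ℂ] H} (hA : IsSelfAdjoint A) {V : H →L[ℂ] H} {τ : ℝ}
    (hSgen : ∀ (x : A.domain) t, HasDerivAt (fun s => S s (x : H)) (Complex.I • S t (A x)) t)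
    (hTgen : ∀ (x : A.domain) t,
      HasDerivAt (fun s => T s (x : H)) (Complex.I • T t (A x + τ • V (x : H))) t)
    (ν : ℝ) (g x : H) (s : ℝ) :
    HasDerivAt (fun s => ⟪g, T s (S (ν - s) x)⟫)
      (Complex.I * τ * ⟪g, T s (V (S (ν - s) x))⟫) s := by
  have hd := hA.dense_domain
  obtain ⟨gs, hgs, hgl⟩ := mem_closure_iff_seq_limit.1 (hd g)
  obtain ⟨xs, hxs, hxl⟩ := mem_closure_iff_seq_limit.1 (hd x)
  have had : ∀ s (g y : H), ⟪g, T s y⟫ = ⟪T (-s) g, y⟫ := fun s g y => by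
    rw [inner_group_apply_left hT0 hTgrp hTiso, neg_neg]
  simp only [had]
  refine hasDerivAt_of_tendstoUniformly (l := Filter.atTop)
    (f := fun n s => ⟪T (-s) (gs n), S (ν - s) (xs n)⟫)
    (g' := fun s => Complex.I * τ * ⟪T (-s) g, V (S (ν - s) x)⟫)
    (f' := fun n s => Complex.I * τ * ⟪T (-s) (gs n), V (S (ν - s) (xs n))⟫) ?_ ?_ ?_ s
  · have hlim : Filter.Tendsto
        (fun n => |τ| * (‖g‖ * (‖V‖ * ‖x - xs n‖) + ‖g - gs n‖ * (‖V‖ * ‖xs n‖)))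
        Filter.atTop (nhds 0) := by
      have h1 : Filter.Tendsto (fun n => ‖x - xs n‖) Filter.atTop (nhds 0) := by
        simpa using (hxl.const_sub x).norm
      have h2 : Filter.Tendsto (fun n => ‖g - gs n‖) Filter.atTop (nhds 0) := by
        simpa using (hgl.const_sub g).norm
      have := (((h1.const_mul ‖V‖).const_mul ‖g‖).add
        (h2.mul (hxl.norm.const_mul ‖V‖))).const_mul |τ|
      simpa using this
    rw [Metric.tendstoUniformly_iff]
    intro ε hε
    filter_upwards [hlim.eventually_lt_const hε] with n hn s
    refine lt_of_le_of_lt ?_ hn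
    have e : ⟪T (-s) g, V (S (ν - s) x)⟫ - ⟪T (-s) (gs n), V (S (ν - s) (xs n))⟫
        = ⟪T (-s) g, V (S (ν - s) (x - xs n))⟫ + ⟪T (-s) (g - gs n), V (S (ν - s) (xs n))⟫ := by
      simp only [map_sub, inner_sub_left, inner_sub_right]; ring
    rw [dist_eq_norm, ← mul_sub, e, norm_mul, norm_mul, Complex.norm_I, one_mul,
      Complex.norm_real, Real.norm_eq_abs]
    have b : ∀ u w : H, ‖⟪T (-s) u, V (S (ν - s) w)⟫‖ ≤ ‖u‖ * (‖V‖ * ‖w‖) := fun u w => by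
      refine (norm_inner_le_norm _ _).trans ?_
      rw [hTiso]
      gcongr
      exact (V.le_opNorm _).trans_eq (by rw [hSiso])
    gcongr
    exact (norm_add_le _ _).trans (add_le_add (b _ _) (b _ _))
  · exact Filter.Eventually.of_forall fun n s =>
      hasDerivAt_inner_duhamel_domain hT0 hTgrp hTiso hS0 hSgrp hSiso hA hSgen hTgen ν
        ⟨_, hgs n⟩ ⟨_, hxs n⟩ s
  · intro s
    exact (((T (-s)).continuous.tendsto _).comp hgl).inner
      (((S (ν - s)).continuous.tendsto _).comp hxl)

end Groups

/-! ### Sums of matrix coefficients along pairs of orthonormal families -/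

/-- The `p`-th powers of the matrix coefficients of `T` along any two finite orthonormal families
sum up to at most `C`. For `p ≥ 1` the least such `C` is `Tr |T| ^ p`. -/
def PairingSumLE (p : ℕ) (T : H →L[ℂ] H) (C : ℝ) : Prop :=
  ∀ (ι : Type) [Fintype ι] (f g : ι → H), Orthonormal ℂ f → Orthonormal ℂ g →
    ∑ i, ‖⟪g i, T (f i)⟫‖ ^ p ≤ C

theorem PairingSumLE.add {T T' : H →L[ℂ] H} {C C' : ℝ} (h : PairingSumLE 1 T C)
    (h' : PairingSumLE 1 T' C') : PairingSumLE 1 (T + T') (C + C') := by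
  intro ι _ f g hf hg
  refine le_trans ?_ (add_le_add (h ι f g hf hg) (h' ι f g hf hg))
  rw [← Finset.sum_add_distrib]
  refine Finset.sum_le_sum fun i _ => ?_
  simp only [pow_one, add_apply, inner_add_right]
  exact norm_add_le _ _

/-- Multiplication by isometries (on the right) and coisometries (on the left) does not increase
the sums of matrix coefficients. -/
theorem PairingSumLE.mul_isometries {p : ℕ} {T : H →L[ℂ] H} {C : ℝ} (h : PairingSumLE p T C)
    {X Y : H →L[ℂ] H} (hX : ∀ x, ‖star X x‖ = ‖x‖) (hY : ∀ x, ‖Y x‖ = ‖x‖) :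
    PairingSumLE p (X * T * Y) C := by
  intro ι _ f g hf hg
  have key : ∀ (Z : H →L[ℂ] H), (∀ x, ‖Z x‖ = ‖x‖) → ∀ f : ι → H, Orthonormal ℂ f →
      Orthonormal ℂ (fun i => Z (f i)) := fun Z hZ f hf =>
    hf.comp_linearIsometry (⟨Z.toLinearMap, hZ⟩ : H →ₗᵢ[ℂ] H)
  have := h ι _ _ (key Y hY f hf) (key _ hX g hg)
  refine le_trans (le_of_eq ?_) this
  refine Finset.sum_congr rfl fun i _ => ?_
  rw [ContinuousLinearMap.star_eq_adjoint, ContinuousLinearMap.adjoint_inner_left]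
  rfl

/-- Mean value inequality in `ℓᵖ`. -/
theorem sum_norm_sub_pow_le {ι : Type} [Fintype ι] {p : ℕ} (hp : 1 ≤ p) {φ φ' : ι → ℝ → ℂ}
    (h : ∀ i s, HasDerivAt (φ i) (φ' i s) s) {K : ℝ} (hK : 0 ≤ K)
    (hb : ∀ s, ∑ i, ‖φ' i s‖ ^ p ≤ K ^ p) (a b : ℝ) :
    ∑ i, ‖φ i b - φ i a‖ ^ p ≤ (K * |b - a|) ^ p := by
  have : Fact ((1 : ENNReal) ≤ p) := ⟨by exact_mod_cast hp⟩
  have hp0 : p ≠ 0 := by omega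
  have hn : ∀ v : PiLp (p : ENNReal) (fun _ : ι => ℂ), ‖v‖ ^ p = ∑ i, ‖v i‖ ^ p := by
    intro v
    have hs : 0 ≤ ∑ i, ‖v i‖ ^ p := Finset.sum_nonneg fun i _ => by positivity
    rw [PiLp.norm_eq_sum (by simpa using Nat.pos_of_ne_zero hp0)]
    simp only [ENNReal.toReal_natCast, Real.rpow_natCast]
    rw [one_div, Real.rpow_inv_natCast_pow hs hp0]
  let L := (PiLp.continuousLinearEquiv (p : ENNReal) ℝ (fun _ : ι => ℂ)).symm
  have hd : ∀ s, HasDerivAt (fun s => L (fun i => φ i s)) (L (fun i => φ' i s)) s := fun s =>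
    L.toContinuousLinearMap.hasFDerivAt.comp_hasDerivAt s (hasDerivAt_pi.2 fun i => h i s)
  have hle : ‖L (fun i => φ i b) - L (fun i => φ i a)‖ ≤ K * ‖b - a‖ := by
    refine convex_univ.norm_image_sub_le_of_norm_hasDerivWithin_le
      (f := fun s => L (fun i => φ i s))
      (fun s _ => (hd s).hasDerivWithinAt) (fun s _ => ?_) (Set.mem_univ a) (Set.mem_univ b)
    refine le_of_pow_le_pow_left₀ hp0 hK ?_
    rw [hn]
    exact hb s
  have := pow_le_pow_left₀ (norm_nonneg _) hle p
  rw [hn] at this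
  exact this

theorem pairingSumLE_duhamel {T S : ℝ → H →L[ℂ] H}
    (hT0 : T 0 = 1) (hTgrp : ∀ s t, T (s + t) = T s * T t) (hTiso : ∀ t x, ‖T t x‖ = ‖x‖)
    (hS0 : S 0 = 1) (hSgrp : ∀ s t, S (s + t) = S s * S t) (hSiso : ∀ t x, ‖S t x‖ = ‖x‖)
    {A : H →ₗ.[ℂ] H} (hA : IsSelfAdjoint A) {V : H →L[ℂ] H} {τ : ℝ}
    (hSgen : ∀ (x : A.domain) t, HasDerivAt (fun s => S s (x : H)) (Complex.I • S t (A x)) t)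
    (hTgen : ∀ (x : A.domain) t,
      HasDerivAt (fun s => T s (x : H)) (Complex.I • T t (A x + τ • V (x : H))) t)
    (ν : ℝ) {p : ℕ} (hp : 1 ≤ p) {X Y : H →L[ℂ] H} {K : ℝ} (hK : 0 ≤ K)
    (h : ∀ s, PairingSumLE p (X * T s * V * S (ν - s) * Y) (K ^ p)) :
    PairingSumLE p (X * (T ν - S ν) * Y) ((|τ| * K * |ν|) ^ p) := by
  intro ι _ f g hf hg
  have key := sum_norm_sub_pow_le hp (K := |τ| * K)
    (fun (i : ι) s => hasDerivAt_inner_duhamel hT0 hTgrp hTiso hS0 hSgrp hSiso hA hSgen hTgen ν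
      (star X (g i)) (Y (f i)) s) (by positivity) (fun s => ?_) 0 ν
  · rw [sub_zero] at key
    refine le_trans (le_of_eq ?_) key
    refine Finset.sum_congr rfl fun i _ => ?_
    simp only [sub_self, hT0, hS0, one_apply_eq_self,
      ContinuousLinearMap.star_eq_adjoint, ContinuousLinearMap.adjoint_inner_left]
    rw [← inner_sub_right, ← map_sub]
    rfl
  · have := mul_le_mul_of_nonneg_left (h s ι f g hf hg) (pow_nonneg (abs_nonneg τ) p)
    rw [Finset.mul_sum, ← mul_pow] at this
    refine le_trans (le_of_eq ?_) this
    refine Finset.sum_congr rfl fun i _ => ?_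
    rw [norm_mul, norm_mul, Complex.norm_I, one_mul, Complex.norm_real, Real.norm_eq_abs, mul_pow,
      ContinuousLinearMap.star_eq_adjoint, ContinuousLinearMap.adjoint_inner_left]
    rfl

/-! ### Finite-dimensional compressions -/

/-- A compression of a self-adjoint operator to a finite-dimensional subspace is diagonalizable. -/
theorem exists_orthonormal_eigenvectors_compression {B : H →L[ℂ] H} (hB : IsSelfAdjoint B)
    (E : Submodule ℂ H) [FiniteDimensional ℂ E] :
    ∃ (n : ℕ) (u : Fin n → H) (a : Fin n → ℝ), Orthonormal ℂ u ∧ (∀ k, u k ∈ E) ∧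
      (∀ x ∈ E, x = ∑ k, ⟪u k, x⟫ • u k) ∧
      ∀ k, E.starProjection (B (u k)) = (a k : ℂ) • u k := by
  let T : E →ₗ[ℂ] E := (E.orthogonalProjectionOnto ∘L B ∘L E.subtypeL).toLinearMap
  have hT : T.IsSymmetric := by
    intro x y
    have := hB.isSymmetric (x : H) (y : H)
    change ⟪E.orthogonalProjectionOnto (B x), y⟫ = ⟪x, E.orthogonalProjectionOnto (B y)⟫
    rw [Submodule.inner_orthogonalProjectionOnto_eq_of_mem_right,
      Submodule.inner_orthogonalProjectionOnto_eq_of_mem_left]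
    exact this
  let b := hT.eigenvectorBasis rfl
  refine ⟨_, fun k => (b k : H), hT.eigenvalues rfl, ?_, fun k => (b k).2, ?_, ?_⟩
  · exact b.orthonormal.comp_linearIsometry E.subtypeₗᵢ
  · intro x hx
    have := congrArg (Subtype.val) (b.sum_repr' ⟨x, hx⟩)
    refine this.symm.trans ?_
    simp
  · intro k
    exact congrArg Subtype.val (hT.apply_eigenvectorBasis rfl k)

/-- The span of the first `m` vectors of a Hilbert basis. -/
def basisSpan (e : HilbertBasis ℕ ℂ H) (m : ℕ) : Submodule ℂ H :=
  Submodule.span ℂ (e '' Set.Iio m)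

instance (e : HilbertBasis ℕ ℂ H) (m : ℕ) : FiniteDimensional ℂ (basisSpan e m) :=
  FiniteDimensional.span_of_finite ℂ ((Set.finite_Iio m).image e)

theorem mem_basisSpan (e : HilbertBasis ℕ ℂ H) {m n : ℕ} (h : n < m) : e n ∈ basisSpan e m :=
  Submodule.subset_span ⟨n, h, rfl⟩

theorem tendsto_starProjection_basisSpan (e : HilbertBasis ℕ ℂ H) (x : H) :
    Filter.Tendsto (fun m => (basisSpan e m).starProjection x) Filter.atTop (nhds x) := by
  refine Submodule.starProjection_tendsto_self (basisSpan e) ?_ x ?_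
  · intro m n h
    exact Submodule.span_mono (Set.image_mono (Set.Iio_subset_Iio h))
  · rw [← e.dense_span]
    refine Submodule.topologicalClosure_mono (Submodule.span_le.2 ?_)
    rintro _ ⟨n, rfl⟩
    exact Submodule.mem_iSup_of_mem (n + 1) (mem_basisSpan e n.lt_succ_self)

/-- Composition is jointly continuous along norm-bounded strongly convergent sequences. -/
theorem tendsto_apply_of_bounded {B : ℕ → H →L[ℂ] H} {B' : H →L[ℂ] H} {M : ℝ}
    (hM : ∀ m, ‖B m‖ ≤ M) (hB : ∀ x, Filter.Tendsto (fun m => B m x) Filter.atTop (nhds (B' x)))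
    {x : ℕ → H} {x' : H} (hx : Filter.Tendsto x Filter.atTop (nhds x')) :
    Filter.Tendsto (fun m => B m (x m)) Filter.atTop (nhds (B' x')) := by
  have h1 : Filter.Tendsto (fun m => B m (x m - x')) Filter.atTop (nhds 0) := by
    have h2 : Filter.Tendsto (fun m => M * ‖x m - x'‖) Filter.atTop (nhds 0) := by
      simpa using (hx.sub_const x').norm.const_mul M
    refine squeeze_zero_norm (fun m => ?_) h2
    exact (B m).le_of_opNorm_le (hM m) _
  have := h1.add (hB x')
  simpa using this

/-- The compression of `B` to the span of the first `m` basis vectors. -/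
def compression (e : HilbertBasis ℕ ℂ H) (B : H →L[ℂ] H) (m : ℕ) : H →L[ℂ] H :=
  (basisSpan e m).starProjection * B * (basisSpan e m).starProjection

theorem norm_compression_le (e : HilbertBasis ℕ ℂ H) (B : H →L[ℂ] H) (m : ℕ) :
    ‖compression e B m‖ ≤ ‖B‖ := by
  have h1 := (basisSpan e m).starProjection_norm_le
  calc ‖compression e B m‖ ≤ 1 * ‖B‖ * 1 := by
        unfold compression
        refine (norm_mul_le _ _).trans ?_
        gcongr
        refine (norm_mul_le _ _).trans ?_
        gcongr
    _ = ‖B‖ := by ring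

theorem tendsto_compression (e : HilbertBasis ℕ ℂ H) (B : H →L[ℂ] H) (x : H) :
    Filter.Tendsto (fun m => compression e B m x) Filter.atTop (nhds (B x)) :=
  tendsto_apply_of_bounded (B' := 1) (fun m => (basisSpan e m).starProjection_norm_le)
    (tendsto_starProjection_basisSpan e)
    ((B.continuous.tendsto x).comp (tendsto_starProjection_basisSpan e x))

open Polynomial in
theorem tendsto_aeval_compression (e : HilbertBasis ℕ ℂ H) (B : H →L[ℂ] H) (q : ℝ[X]) (x : H) :
    Filter.Tendsto (fun m => aeval (compression e B m) q x) Filter.atTop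
      (nhds (aeval B q x)) := by
  have hpow : ∀ k : ℕ, Filter.Tendsto (fun m => (compression e B m ^ k) x) Filter.atTop
      (nhds ((B ^ k) x)) := by
    intro k
    induction k with
    | zero => simp
    | succ k ih =>
      simp only [pow_succ', mul_apply_eq_comp]
      exact tendsto_apply_of_bounded (norm_compression_le e B) (tendsto_compression e B) ih
  induction q using Polynomial.induction_on' with
  | add p q hp hq => simpa using hp.add hq
  | monomial k r =>
    simp only [aeval_monomial, Algebra.algebraMap_eq_smul_one, smul_mul_assoc, one_mul,
      smul_apply]
    exact (hpow k).const_smul r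

open Polynomial in
theorem aeval_apply_of_apply_eq_smul {B : H →L[ℂ] H} {x : H} {a : ℝ} (h : B x = (a : ℂ) • x)
    (q : ℝ[X]) : aeval B q x = ((q.eval a : ℝ) : ℂ) • x := by
  have hpow : ∀ k : ℕ, (B ^ k) x = ((a ^ k : ℝ) : ℂ) • x := by
    intro k
    induction k with
    | zero => simp
    | succ k ih => rw [pow_succ', mul_apply_eq_comp, ih, map_smul, h, smul_smul]; push_cast; ring_nf
  induction q using Polynomial.induction_on' with
  | add p q hp hq => simp [hp, hq, add_smul]
  | monomial k r =>
    simp only [aeval_monomial, Algebra.algebraMap_eq_smul_one, smul_mul_assoc, one_mul,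
      smul_apply, hpow, eval_monomial]
    rw [← Complex.coe_smul, smul_smul]
    push_cast
    rfl

/-! ### From matrix coefficients to traces -/

theorem sum_sqrt_eigenvalues_compression_le {p : ℕ} (hp : 1 ≤ p) {T : H →L[ℂ] H} {C : ℝ}
    (h : PairingSumLE p T C) {E : Submodule ℂ H} [FiniteDimensional ℂ E] {n : ℕ}
    {u : Fin n → H} {a : Fin n → ℝ} (hu : Orthonormal ℂ u) (huE : ∀ k, u k ∈ E)
    (ha : ∀ k, E.starProjection ((star T * T) (u k)) = (a k : ℂ) • u k) :
    ∑ k, √(a k) ^ p ≤ C := by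
  have hin : ∀ j k, ⟪T (u j), T (u k)⟫ = (a k : ℂ) * ⟪u j, u k⟫ := by
    intro j k
    rw [← inner_smul_right, ← ha, ← Submodule.inner_starProjection_left_eq_right,
      Submodule.starProjection_eq_self_iff.2 (huE j), mul_apply_eq_comp,
      ContinuousLinearMap.star_eq_adjoint, ContinuousLinearMap.adjoint_inner_right]
  have hna : ∀ k, a k = ‖T (u k)‖ ^ 2 := by
    intro k
    have h1 := hin k k
    rw [inner_self_eq_norm_sq_to_K, inner_self_eq_norm_sq_to_K, hu.1 k] at h1
    simp only [RCLike.ofReal_one, one_pow, mul_one, Complex.coe_algebraMap] at h1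
    exact_mod_cast h1.symm
  have hs : ∀ k, √(a k) = ‖T (u k)‖ := fun k => by rw [hna, Real.sqrt_sq (norm_nonneg _)]
  let ι := {k : Fin n // a k ≠ 0}
  let g : ι → H := fun k => ((√(a k) : ℝ) : ℂ)⁻¹ • T (u k)
  have hT0 : ∀ k : ι, ((√(a k) : ℝ) : ℂ) ≠ 0 := by
    intro k h0
    have h1 : √(a k) = 0 := by exact_mod_cast h0
    rw [hs] at h1
    exact k.2 (by rw [hna, h1]; simp)
  have hsq : ∀ k, ((√(a k) : ℝ) : ℂ) * ((√(a k) : ℝ) : ℂ) = a k := fun k => by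
    rw [← Complex.ofReal_mul, Real.mul_self_sqrt (by rw [hna]; positivity)]
  have hg : Orthonormal ℂ g := by
    classical
    rw [orthonormal_iff_ite]
    intro j k
    have hjk := orthonormal_iff_ite.1 hu j k
    simp only [g, inner_smul_left, inner_smul_right, hin, hjk, map_inv₀, Complex.conj_ofReal]
    by_cases hjk' : j = k
    · subst hjk'
      have := hT0 j
      simp only [if_true]
      rw [← hsq]
      field_simp
    · have : (j : Fin n) ≠ k := fun h => hjk' (Subtype.ext h)
      simp [hjk', this]
  have := h ι (fun k => u k) g (hu.comp _ Subtype.val_injective) hg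
  refine le_trans (le_of_eq ?_) this
  have hterm : ∀ k : ι, ‖⟪g k, T (u k)⟫‖ ^ p = √(a k) ^ p := by
    intro k
    congr 1
    have h1 : ⟪g k, T (u k)⟫ = ((√(a k) : ℝ) : ℂ) := by
      have := hT0 k
      simp only [g, inner_smul_left, hin, map_inv₀, Complex.conj_ofReal]
      rw [inner_self_eq_norm_sq_to_K, hu.1 k, ← hsq]
      field_simp
      simp
    rw [h1, Complex.norm_real, Real.norm_of_nonneg (Real.sqrt_nonneg _)]
  simp only [hterm]
  rw [← Finset.sum_subtype (p := fun k : Fin n => a k ≠ 0)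
    (Finset.univ.filter fun k : Fin n => a k ≠ 0) (by simp) fun k => √(a k) ^ p]
  refine (Finset.sum_filter_of_ne (p := fun k => a k ≠ 0) fun k _ hk ha0 => hk ?_).symm
  rw [ha0, Real.sqrt_zero, zero_pow (by omega)]

theorem absCLM_pow_eq_cfc (T : H →L[ℂ] H) (p : ℕ) :
    absCLM T ^ p = cfc (fun x : ℝ => √x ^ p) (star T * T) := by
  have h0 : 0 ≤ star T * T := star_mul_self_nonneg T
  rw [absCLM, CFC.sqrt_eq_real_sqrt _ h0, cfcₙ_eq_cfc,
    cfc_pow (fun x : ℝ => √x) p (star T * T) (by fun_prop) (IsSelfAdjoint.star_mul_self T)]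

theorem absCLM_nonneg (T : H →L[ℂ] H) : 0 ≤ absCLM T := CFC.sqrt_nonneg _

theorem re_inner_absCLM_pow_nonneg (T : H →L[ℂ] H) (p : ℕ) (x : H) :
    0 ≤ (⟪x, (absCLM T ^ p) x⟫).re := by
  have h : 0 ≤ absCLM T ^ p := CStarAlgebra.pow_nonneg (absCLM_nonneg T) p
  exact ((ContinuousLinearMap.nonneg_iff_isPositive _).1 h).re_inner_nonneg_right x

open Polynomial in
theorem sum_inner_absCLM_pow_le (e : HilbertBasis ℕ ℂ H) {p : ℕ} (hp : 1 ≤ p) {T : H →L[ℂ] H}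
    {C : ℝ} (h : PairingSumLE p T C) (N : ℕ) :
    ∑ n ∈ Finset.range N, (⟪e n, (absCLM T ^ p) (e n)⟫).re ≤ C := by
  set A := star T * T with hA
  have hA0 : 0 ≤ A := star_mul_self_nonneg T
  have hAsa : IsSelfAdjoint A := IsSelfAdjoint.star_mul_self T
  have hnt : Nontrivial H := ⟨e 0, 0, e.orthonormal.ne_zero 0⟩
  have hcont : Continuous fun x : ℝ => √x ^ p := by fun_prop
  have hmain : ∀ ε > 0,
      ∑ n ∈ Finset.range N, (⟪e n, (absCLM T ^ p) (e n)⟫).re ≤ C + ε * (2 * N) := by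
    intro ε hε
    obtain ⟨q, hq⟩ := exists_polynomial_near_of_continuousOn 0 ‖A‖ (fun x => √x ^ p)
      hcont.continuousOn ε hε
    have hop : ‖absCLM T ^ p - aeval A q‖ ≤ ε := by
      rw [absCLM_pow_eq_cfc, ← cfc_polynomial q A hAsa, ← cfc_sub ..]
      refine norm_cfc_le hε.le fun x hx => ?_
      have hx0 : 0 ≤ x := spectrum_nonneg_of_nonneg hA0 hx
      have hx1 : x ≤ ‖A‖ := (le_abs_self x).trans (spectrum.norm_le_norm_of_mem hx)
      rw [Real.norm_eq_abs, abs_sub_comm]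
      exact (hq x ⟨hx0, hx1⟩).le
    have hstep : ∀ n, (⟪e n, (absCLM T ^ p) (e n)⟫).re ≤ (⟪e n, aeval A q (e n)⟫).re + ε := by
      intro n
      have h1 : ‖⟪e n, (absCLM T ^ p - aeval A q) (e n)⟫‖ ≤ ε := by
        refine (norm_inner_le_norm _ _).trans ?_
        rw [e.orthonormal.1 n, one_mul]
        refine ((absCLM T ^ p - aeval A q).le_of_opNorm_le hop _).trans_eq ?_
        rw [e.orthonormal.1 n, mul_one]
      have h2 := (Complex.re_le_norm _).trans h1
      rw [sub_apply, inner_sub_right, Complex.sub_re] at h2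
      linarith
    have hlim : Filter.Tendsto
        (fun m => ∑ n ∈ Finset.range N, (⟪e n, aeval (compression e A m) q (e n)⟫).re)
        Filter.atTop (nhds (∑ n ∈ Finset.range N, (⟪e n, aeval A q (e n)⟫).re)) :=
      tendsto_finsetSum _ fun n _ => (Complex.continuous_re.tendsto _).comp
        (tendsto_const_nhds.inner (tendsto_aeval_compression e A q (e n)))
    have hle : ∑ n ∈ Finset.range N, (⟪e n, aeval A q (e n)⟫).re ≤ C + ε * N := by
      refine le_of_tendsto hlim (Filter.eventually_atTop.2 ⟨N, fun m hm => ?_⟩)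
      obtain ⟨d, u, a, hu, huE, hsum, ha⟩ :=
        exists_orthonormal_eigenvectors_compression hAsa (basisSpan e m)
      have hsing := sum_sqrt_eigenvalues_compression_le hp h hu huE ha
      have heig : ∀ k, compression e A m (u k) = (a k : ℂ) • u k := by
        intro k
        rw [← ha]
        simp only [compression, mul_apply_eq_comp,
          Submodule.starProjection_eq_self_iff.2 (huE k)]
      have hak : ∀ k, a k ∈ Set.Icc 0 ‖A‖ := by
        intro k
        have h1 : ((a k : ℝ) : ℂ) = ⟪u k, A (u k)⟫ := by
          rw [← Submodule.starProjection_eq_self_iff.2 (huE k),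
            Submodule.inner_starProjection_left_eq_right,
            Submodule.starProjection_eq_self_iff.2 (huE k), ha, inner_smul_right,
            inner_self_eq_norm_sq_to_K, hu.1 k]
          simp
        have h2 := ((ContinuousLinearMap.nonneg_iff_isPositive _).1 hA0).re_inner_nonneg_right (u k)
        rw [← h1] at h2
        refine ⟨by simpa using h2, ?_⟩
        have h3 : ‖((a k : ℝ) : ℂ)‖ ≤ ‖A‖ := by
          rw [h1]
          refine (norm_inner_le_norm _ _).trans ?_
          rw [hu.1 k, one_mul]
          exact (A.le_opNorm _).trans_eq (by rw [hu.1 k, mul_one])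
        rw [Complex.norm_real] at h3
        exact (le_abs_self _).trans h3
      have hexp : ∀ n ∈ Finset.range N, (⟪e n, aeval (compression e A m) q (e n)⟫).re
          ≤ ∑ k, √(a k) ^ p * ‖⟪e n, u k⟫‖ ^ 2 + ε * ∑ k, ‖⟪u k, e n⟫‖ ^ 2 := by
        intro n hn
        have hnE := mem_basisSpan e ((Finset.mem_range.1 hn).trans_le hm)
        have h1 : aeval (compression e A m) q (e n)
            = ∑ k, ⟪u k, e n⟫ • ((q.eval (a k) : ℝ) : ℂ) • u k := by
          conv_lhs => rw [hsum _ hnE]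
          simp only [map_sum, map_smul, aeval_apply_of_apply_eq_smul (heig _)]
        rw [h1, inner_sum, Complex.re_sum, Finset.mul_sum, ← Finset.sum_add_distrib]
        refine Finset.sum_le_sum fun k _ => ?_
        rw [inner_smul_right, inner_smul_right]
        have h2 : ⟪u k, e n⟫ * (((q.eval (a k) : ℝ) : ℂ) * ⟪e n, u k⟫)
            = ((q.eval (a k) * ‖⟪u k, e n⟫‖ ^ 2 : ℝ) : ℂ) := by
          rw [← inner_conj_symm (e n) (u k)]
          push_cast
          rw [← Complex.mul_conj']
          ring
        rw [h2, Complex.ofReal_re, norm_inner_symm (e n) (u k), ← add_mul]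
        refine mul_le_mul_of_nonneg_right ?_ (by positivity)
        have := (abs_lt.1 (hq _ (hak k))).2
        linarith
      refine (Finset.sum_le_sum hexp).trans ?_
      rw [Finset.sum_add_distrib]
      refine add_le_add ?_ ?_
      · rw [Finset.sum_comm]
        refine le_trans (Finset.sum_le_sum fun k _ => ?_) hsing
        rw [← Finset.mul_sum]
        refine mul_le_of_le_one_right (by positivity) ?_
        refine (e.orthonormal.sum_inner_products_le (u k)).trans ?_
        rw [hu.1 k, one_pow]
      · rw [← Finset.mul_sum]
        refine mul_le_mul_of_nonneg_left ?_ hε.le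
        calc _ ≤ ∑ n ∈ Finset.range N, (1 : ℝ) := Finset.sum_le_sum fun n _ => by
              refine (hu.sum_inner_products_le (e n)).trans ?_
              rw [e.orthonormal.1 n, one_pow]
          _ = N := by simp
    calc _ ≤ ∑ n ∈ Finset.range N, ((⟪e n, aeval A q (e n)⟫).re + ε) :=
          Finset.sum_le_sum fun n _ => hstep n
      _ ≤ C + ε * (2 * N) := by
          rw [Finset.sum_add_distrib]
          simp only [Finset.sum_const, Finset.card_range, nsmul_eq_mul]
          linarith
  have hlim : Filter.Tendsto (fun ε : ℝ => C + ε * (2 * N)) (nhdsWithin 0 (Set.Ioi 0)) (nhds C) := by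
    have : Continuous fun ε : ℝ => C + ε * (2 * N) := by fun_prop
    simpa using (this.tendsto 0).mono_left nhdsWithin_le_nhds
  exact ge_of_tendsto hlim (Filter.eventually_of_mem self_mem_nhdsWithin hmain)

/-! ### From traces to matrix coefficients -/

theorem inner_sqrt_apply {Z : H →L[ℂ] H} (hZ : 0 ≤ Z) (x y : H) :
    ⟪x, Z y⟫ = ⟪CFC.sqrt Z x, CFC.sqrt Z y⟫ := by
  have h1 : (CFC.sqrt Z).IsSymmetric := (IsSelfAdjoint.of_nonneg (CFC.sqrt_nonneg Z)).isSymmetric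
  have h2 := h1 x (CFC.sqrt Z y)
  rw [ContinuousLinearMap.coe_coe] at h2
  rw [h2, ← mul_apply_eq_comp, CFC.sqrt_mul_sqrt_self Z hZ]

theorem re_inner_self_apply_eq {Z : H →L[ℂ] H} (hZ : 0 ≤ Z) (x : H) :
    (⟪x, Z x⟫).re = ‖CFC.sqrt Z x‖ ^ 2 := by
  rw [inner_sqrt_apply hZ, inner_self_eq_norm_sq_to_K]
  norm_cast

theorem norm_inner_sq_le_absCLM {V : H →L[ℂ] H} (hV : IsSelfAdjoint V) (x y : H) :
    ‖⟪x, V y⟫‖ ^ 2 ≤ (⟪x, absCLM V x⟫).re * (⟪y, absCLM V y⟫).re := by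
  have hp : 0 ≤ V⁺ := CFC.posPart_nonneg V
  have hn : 0 ≤ V⁻ := CFC.negPart_nonneg V
  have habs : absCLM V = V⁺ + V⁻ := (CFC.posPart_add_negPart V hV).symm
  have hre : ∀ z, (⟪z, absCLM V z⟫).re = ‖CFC.sqrt V⁺ z‖ ^ 2 + ‖CFC.sqrt V⁻ z‖ ^ 2 := by
    intro z
    rw [habs, add_apply, inner_add_right, Complex.add_re, re_inner_self_apply_eq hp,
      re_inner_self_apply_eq hn]
  have h1 : ‖⟪x, V y⟫‖ ≤ ‖CFC.sqrt V⁺ x‖ * ‖CFC.sqrt V⁺ y‖ + ‖CFC.sqrt V⁻ x‖ * ‖CFC.sqrt V⁻ y‖ := by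
    conv_lhs => rw [← CFC.posPart_sub_negPart V hV]
    rw [sub_apply, inner_sub_right, inner_sqrt_apply hp, inner_sqrt_apply hn]
    exact (norm_sub_le _ _).trans (add_le_add (norm_inner_le_norm _ _) (norm_inner_le_norm _ _))
  rw [hre, hre]
  refine (pow_le_pow_left₀ (norm_nonneg _) h1 2).trans ?_
  nlinarith [sq_nonneg (‖CFC.sqrt V⁺ x‖ * ‖CFC.sqrt V⁻ y‖ - ‖CFC.sqrt V⁻ x‖ * ‖CFC.sqrt V⁺ y‖)]

theorem re_inner_cube_eq {P : H →L[ℂ] H} (hP : 0 ≤ P) (x : H) :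
    (⟪x, (P ^ 3) x⟫).re = ‖(CFC.sqrt P * P) x‖ ^ 2 := by
  have hs : P.IsSymmetric := (IsSelfAdjoint.of_nonneg hP).isSymmetric
  have h1 := hs x (P (P x))
  rw [ContinuousLinearMap.coe_coe] at h1
  rw [pow_succ', pow_two, mul_apply_eq_comp, mul_apply_eq_comp, ← h1, re_inner_self_apply_eq hP]
  rfl

theorem re_inner_pow_three_le {P : H →L[ℂ] H} (hP : 0 ≤ P) {x : H} (hx : ‖x‖ = 1) :
    (⟪x, P x⟫).re ^ 3 ≤ (⟪x, (P ^ 3) x⟫).re := by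
  have hs : P.IsSymmetric := (IsSelfAdjoint.of_nonneg hP).isSymmetric
  have h1 : (⟪x, P x⟫).re ≤ ‖P x‖ := by
    refine (Complex.re_le_norm _).trans ((norm_inner_le_norm _ _).trans_eq ?_)
    rw [hx, one_mul]
  have h2 : ‖P x‖ ^ 2 ≤ ‖CFC.sqrt P x‖ * ‖(CFC.sqrt P * P) x‖ := by
    have h3 := hs x (P x)
    rw [ContinuousLinearMap.coe_coe] at h3
    have h4 : ‖P x‖ ^ 2 = ‖⟪x, P (P x)⟫‖ := by
      rw [← h3, inner_self_eq_norm_sq_to_K]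
      simp
    rw [h4, inner_sqrt_apply hP]
    exact norm_inner_le_norm _ _
  rw [re_inner_cube_eq hP]
  rw [re_inner_self_apply_eq hP] at h1 ⊢
  set a := ‖CFC.sqrt P x‖
  set c := ‖(CFC.sqrt P * P) x‖
  have ha : 0 ≤ a := norm_nonneg _
  have hc : 0 ≤ c := norm_nonneg _
  have h5 : (a ^ 2) ^ 2 ≤ a * c := (pow_le_pow_left₀ (by positivity) h1 2).trans h2
  rcases ha.eq_or_lt with h0 | h0
  · rw [← h0]; simpa using sq_nonneg c
  · have h6 : a ^ 3 ≤ c := by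
      refine le_of_mul_le_mul_left ?_ h0
      linarith [h5, show (a ^ 2) ^ 2 = a * a ^ 3 by ring]
    calc (a ^ 2) ^ 3 = (a ^ 3) ^ 2 := by ring
      _ ≤ c ^ 2 := pow_le_pow_left₀ (by positivity) h6 2

theorem sum_norm_sq_le_tsum (e : HilbertBasis ℕ ℂ H) {B : H →L[ℂ] H}
    (hB : Summable fun n => ‖star B (e n)‖ ^ 2) {ι : Type} [Fintype ι] {f : ι → H}
    (hf : Orthonormal ℂ f) : ∑ i, ‖B (f i)‖ ^ 2 ≤ ∑' n, ‖star B (e n)‖ ^ 2 := by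
  have h1 : ∀ i, HasSum (fun n => ‖⟪f i, star B (e n)⟫‖ ^ 2) (‖B (f i)‖ ^ 2) := by
    intro i
    have h2 := e.hasSum_inner_mul_inner (B (f i)) (B (f i))
    have h3 := (Complex.hasSum_re h2)
    rw [inner_self_eq_norm_sq_to_K] at h3
    convert h3 using 1
    · funext n
      rw [ContinuousLinearMap.star_eq_adjoint, ContinuousLinearMap.adjoint_inner_right,
        ← inner_conj_symm (e n) (B (f i)), Complex.mul_conj']
      norm_cast
    · norm_cast
  refine hasSum_le (fun n => ?_) (hasSum_sum fun i _ => h1 i) hB.hasSum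
  exact hf.sum_inner_products_le _

theorem IsSchatten3.sum_re_inner_le {e : HilbertBasis ℕ ℂ H} {V : H →L[ℂ] H} (h : IsSchatten3 e V)
    {ι : Type} [Fintype ι] {f : ι → H} (hf : Orthonormal ℂ f) :
    ∑ i, (⟪f i, (absCLM V ^ 3) (f i)⟫).re ≤ ∑' n, (⟪e n, (absCLM V ^ 3) (e n)⟫).re := by
  have hP := absCLM_nonneg V
  unfold IsSchatten3 at h
  simp only [re_inner_cube_eq hP] at h ⊢
  have hsa : star (CFC.sqrt (absCLM V) * absCLM V) = CFC.sqrt (absCLM V) * absCLM V := by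
    have h1 : star (absCLM V) = absCLM V := IsSelfAdjoint.of_nonneg hP
    have h2 : star (CFC.sqrt (absCLM V)) = CFC.sqrt (absCLM V) :=
      IsSelfAdjoint.of_nonneg (CFC.sqrt_nonneg _)
    have h3 := CFC.sqrt_mul_sqrt_self (absCLM V) hP
    rw [star_mul, h1, h2]
    generalize CFC.sqrt (absCLM V) = R at h3
    rw [← h3, mul_assoc]
  have := sum_norm_sq_le_tsum e (B := CFC.sqrt (absCLM V) * absCLM V) (by rwa [hsa]) hf
  rwa [hsa] at this

/-- The matrix coefficients of a self-adjoint Schatten class operator along two orthonormal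
families are controlled by its Schatten norm. -/
theorem IsSchatten3.pairingSumLE {e : HilbertBasis ℕ ℂ H} {V : H →L[ℂ] H} (h : IsSchatten3 e V)
    (hV : IsSelfAdjoint V) : PairingSumLE 3 V (∑' n, (⟪e n, (absCLM V ^ 3) (e n)⟫).re) := by
  intro ι _ f g hf hg
  have hP := absCLM_nonneg V
  have hterm : ∀ i, ‖⟪g i, V (f i)⟫‖ ^ 3 ≤
      ((⟪g i, (absCLM V ^ 3) (g i)⟫).re + (⟪f i, (absCLM V ^ 3) (f i)⟫).re) / 2 := by
    intro i
    have h1 := norm_inner_sq_le_absCLM hV (g i) (f i)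
    have h2 := re_inner_pow_three_le hP (hg.1 i)
    have h3 := re_inner_pow_three_le hP (hf.1 i)
    have h4 : 0 ≤ (⟪g i, absCLM V (g i)⟫).re := by
      rw [re_inner_self_apply_eq hP]; positivity
    have h5 : 0 ≤ (⟪f i, absCLM V (f i)⟫).re := by
      rw [re_inner_self_apply_eq hP]; positivity
    have h6 := pow_le_pow_left₀ (by positivity) h1 3
    rw [mul_pow] at h6
    have h7 := h6.trans (mul_le_mul h2 h3 (by positivity) ((pow_nonneg h4 3).trans h2))
    have h8 := (pow_nonneg h4 3).trans h2
    have h9 := (pow_nonneg h5 3).trans h3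
    refine le_of_sq_le_sq ?_ (by positivity)
    nlinarith [sq_nonneg ((⟪g i, (absCLM V ^ 3) (g i)⟫).re - (⟪f i, (absCLM V ^ 3) (f i)⟫).re)]
  refine (Finset.sum_le_sum fun i _ => hterm i).trans ?_
  rw [← Finset.sum_div, Finset.sum_add_distrib]
  linarith [h.sum_re_inner_le hf, h.sum_re_inner_le hg]

/-! ### Hölder's inequality for triple products -/

theorem PairingSumLE.sum {α : Type} {s : Finset α} {T : α → H →L[ℂ] H} {C : α → ℝ}
    (h : ∀ a ∈ s, PairingSumLE 1 (T a) (C a)) :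
    PairingSumLE 1 (∑ a ∈ s, T a) (∑ a ∈ s, C a) := by
  classical
  induction s using Finset.induction_on with
  | empty =>
    intro ι _ f g _ _
    simp
  | insert a s ha ih =>
    rw [Finset.sum_insert ha, Finset.sum_insert ha]
    exact (h a (Finset.mem_insert_self _ _)).add
      (ih fun b hb => h b (Finset.mem_insert_of_mem hb))

theorem PairingSumLE.smul {T : H →L[ℂ] H} {C r : ℝ} (h : PairingSumLE 1 T C) (hr : 0 ≤ r) :
    PairingSumLE 1 ((r : ℂ) • T) (r * C) := by
  intro ι _ f g hf hg
  refine le_trans (le_of_eq ?_) (mul_le_mul_of_nonneg_left (h ι f g hf hg) hr)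
  rw [Finset.mul_sum]
  refine Finset.sum_congr rfl fun i _ => ?_
  rw [smul_apply, inner_smul_right, pow_one, pow_one, norm_mul, Complex.norm_real,
    Real.norm_of_nonneg hr]

theorem PairingSumLE.mono {p : ℕ} {T : H →L[ℂ] H} {C C' : ℝ} (h : PairingSumLE p T C)
    (hC : C ≤ C') : PairingSumLE p T C' :=
  fun ι _ f g hf hg => (h ι f g hf hg).trans hC

theorem PairingSumLE.of_tendsto {p : ℕ} {T : ℕ → H →L[ℂ] H} {T' : H →L[ℂ] H} {C : ℝ}
    (h : ∀ m, PairingSumLE p (T m) C)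
    (hT : ∀ x, Filter.Tendsto (fun m => T m x) Filter.atTop (nhds (T' x))) :
    PairingSumLE p T' C := by
  intro ι _ f g hf hg
  refine le_of_tendsto' (x := Filter.atTop) (tendsto_finsetSum _ fun i _ =>
    ((tendsto_const_nhds.inner (hT (f i))).norm.pow p)) fun m => h m ι f g hf hg

/-- The operator with eigenvectors `u k` and eigenvalues `c k`. -/
def diagonalOperator {n : ℕ} (u : Fin n → H) (c : Fin n → ℂ) : H →L[ℂ] H :=
  ∑ k, c k • (innerSL ℂ (u k)).smulRight (u k)

theorem diagonalOperator_apply {n : ℕ} (u : Fin n → H) (c : Fin n → ℂ) (x : H) :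
    diagonalOperator u c x = ∑ k, (c k * ⟪u k, x⟫) • u k := by
  simp [diagonalOperator, smul_smul]

theorem norm_diagonalOperator_le {n : ℕ} {u : Fin n → H} (hu : Orthonormal ℂ u) {c : Fin n → ℂ}
    (hc : ∀ k, ‖c k‖ ≤ 1) : ‖diagonalOperator u c‖ ≤ 1 := by
  refine ContinuousLinearMap.opNorm_le_bound _ zero_le_one fun x => ?_
  rw [one_mul]
  refine le_of_sq_le_sq ?_ (norm_nonneg _)
  have h1 : ‖diagonalOperator u c x‖ ^ 2 = ∑ k, ‖c k * ⟪u k, x⟫‖ ^ 2 := by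
    have h2 := hu.inner_sum (fun k => c k * ⟪u k, x⟫) (fun k => c k * ⟪u k, x⟫) Finset.univ
    rw [← diagonalOperator_apply, inner_self_eq_norm_sq_to_K] at h2
    simp only [Complex.conj_mul'] at h2
    apply Complex.ofReal_injective
    push_cast
    exact h2
  rw [h1]
  refine le_trans (Finset.sum_le_sum fun k _ => ?_) (hu.sum_inner_products_le x)
  rw [norm_mul, mul_pow]
  exact mul_le_of_le_one_left (by positivity) (pow_le_one₀ (norm_nonneg _) (hc k))

theorem pairingSumLE_mul_diagonalOperator_mul {n : ℕ} {u : Fin n → H} (hu : Orthonormal ℂ u)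
    (c : Fin n → ℂ) {X Y : H →L[ℂ] H} (hX : ‖X‖ ≤ 1) (hY : ‖Y‖ ≤ 1) :
    PairingSumLE 1 (X * diagonalOperator u c * Y) (∑ k, ‖c k‖) := by
  intro ι _ f g hf hg
  have hterm : ∀ i, ‖⟪g i, (X * diagonalOperator u c * Y) (f i)⟫‖ ^ 1 ≤
      ∑ k, ‖c k‖ * ((‖⟪g i, X (u k)⟫‖ ^ 2 + ‖⟪f i, star Y (u k)⟫‖ ^ 2) / 2) := by
    intro i
    rw [pow_one, mul_apply_eq_comp, mul_apply_eq_comp, diagonalOperator_apply, map_sum, inner_sum]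
    refine (norm_sum_le _ _).trans (Finset.sum_le_sum fun k _ => ?_)
    rw [map_smul, inner_smul_right, norm_mul, norm_mul, mul_assoc,
      norm_inner_symm (f i), ContinuousLinearMap.star_eq_adjoint,
      ContinuousLinearMap.adjoint_inner_left]
    gcongr
    nlinarith [sq_nonneg (‖⟪u k, Y (f i)⟫‖ - ‖⟪g i, X (u k)⟫‖)]
  refine (Finset.sum_le_sum fun i _ => hterm i).trans ?_
  rw [Finset.sum_comm]
  refine Finset.sum_le_sum fun k _ => ?_
  rw [← Finset.mul_sum, ← Finset.sum_div, Finset.sum_add_distrib]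
  refine mul_le_of_le_one_right (norm_nonneg _) ?_
  have hb : ∀ Z : H →L[ℂ] H, ‖Z‖ ≤ 1 → ∀ f : ι → H, Orthonormal ℂ f →
      ∑ i, ‖⟪f i, Z (u k)⟫‖ ^ 2 ≤ 1 := by
    intro Z hZ f hf
    refine (hf.sum_inner_products_le _).trans (pow_le_one₀ (norm_nonneg _) ?_)
    refine (Z.le_of_opNorm_le hZ _).trans_eq ?_
    rw [hu.1 k, one_mul]
  linarith [hb X hX g hg, hb (star Y) (by rwa [norm_star]) f hf]

/-- Layer-cake proof of Hölder's inequality for finite-rank operators. -/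
theorem pairingSumLE_diagonalOperator_triple {n : ℕ} {u : Fin n → H} (hu : Orthonormal ℂ u)
    (a : Fin n → ℝ) {W W' : H →L[ℂ] H} (hW : ‖W‖ ≤ 1) (hW' : ‖W'‖ ≤ 1)
    (ha : Antitone fun k => |a k|) :
    PairingSumLE 1 (diagonalOperator u (fun k => (a k : ℂ)) * W *
      diagonalOperator u (fun k => (a k : ℂ)) * W' * diagonalOperator u (fun k => (a k : ℂ)))
      (∑ k, |a k| ^ 3) := by
  let μ : ℕ → ℝ := fun j => if h : j < n then |a ⟨j, h⟩| else 0
  let δ : ℕ → ℝ := fun j => μ j - μ (j + 1)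
  have hδ : ∀ j, 0 ≤ δ j := by
    intro j
    simp only [δ, μ, sub_nonneg]
    by_cases h1 : j + 1 < n
    · rw [dif_pos h1, dif_pos (by omega)]
      exact ha (Fin.mk_le_mk.2 (by omega))
    · rw [dif_neg h1]
      split_ifs
      · exact abs_nonneg _
      · exact le_rfl
  have hμ : ∀ q ∈ Finset.range n, ∑ j ∈ Finset.range n, (if q ≤ j then δ j else 0) = μ q := by
    intro q hq
    have hq' := (Finset.mem_range.1 hq).le
    rw [← Finset.sum_filter]
    have h1 : (Finset.range n).filter (fun j => q ≤ j) = Finset.Ico q n := by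
      ext j; simp; omega
    have h2 : μ n = 0 := by simp [μ]
    have h3 := Finset.sum_Ico_sub μ hq'
    rw [h1]
    simp only [δ]
    rw [h2] at h3
    have h4 : ∑ j ∈ Finset.Ico q n, (μ j - μ (j + 1)) = -∑ j ∈ Finset.Ico q n, (μ (j + 1) - μ j) := by
      rw [← Finset.sum_neg_distrib]
      exact Finset.sum_congr rfl fun _ _ => by ring
    rw [h4, h3]; ring
  let s : ℕ → Fin n → ℂ := fun j k => if (k : ℕ) ≤ j then ((SignType.sign (a k) : ℝ) : ℂ) else 0
  have hs : ∀ j k, ‖s j k‖ ≤ if (k : ℕ) ≤ j then 1 else 0 := by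
    intro j k
    simp only [s]
    split_ifs
    · rw [Complex.norm_real]
      rcases lt_trichotomy (a k) 0 with h | h | h <;> simp [h]
    · simp
  have hs1 : ∀ j k, ‖s j k‖ ≤ 1 := fun j k => (hs j k).trans (by split_ifs <;> norm_num)
  let D : ℕ → H →L[ℂ] H := fun j => diagonalOperator u (s j)
  have hD1 : ∀ j, ‖D j‖ ≤ 1 := fun j => norm_diagonalOperator_le hu (hs1 j)
  have hD : diagonalOperator u (fun k => (a k : ℂ)) = ∑ j ∈ Finset.range n, (δ j : ℂ) • D j := by
    simp only [D, diagonalOperator, Finset.smul_sum]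
    rw [Finset.sum_comm]
    refine Finset.sum_congr rfl fun k _ => ?_
    simp only [smul_smul]
    rw [← Finset.sum_smul]
    congr 1
    have h1 := hμ k (Finset.mem_range.2 k.2)
    have h2 : μ k = |a k| := by simp [μ]
    rw [← sign_mul_abs (a k), ← h2, ← h1, Finset.mul_sum]
    push_cast
    refine Finset.sum_congr rfl fun j _ => ?_
    simp only [s]
    split_ifs
    · ring
    · simp
  have hsum : ∀ j < n, ∑ k, ‖s j k‖ ≤ ((j + 1 : ℕ) : ℝ) := by
    intro j hj
    refine (Finset.sum_le_sum fun k _ => hs j k).trans ?_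
    rw [Fin.sum_univ_eq_sum_range (fun k => if k ≤ j then (1 : ℝ) else 0) n, ← Finset.sum_filter]
    have h1 : (Finset.range n).filter (fun k => k ≤ j) = Finset.range (j + 1) := by
      ext k; simp; omega
    rw [h1]
    simp
  have hrank : ∀ i ∈ Finset.range n, ∀ j ∈ Finset.range n, ∀ k ∈ Finset.range n,
      PairingSumLE 1 (D i * W * D j * W' * D k)
        (∑ q ∈ Finset.range n, if q ≤ i ∧ q ≤ j ∧ q ≤ k then 1 else 0) := by
    intro i hi j hj k hk
    rw [Finset.mem_range] at hi hj hk
    have hcount : ∀ m, m < n → (m = i ∨ m = j ∨ m = k) → m ≤ i → m ≤ j → m ≤ k →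
        ((m + 1 : ℕ) : ℝ) ≤ ∑ q ∈ Finset.range n, if q ≤ i ∧ q ≤ j ∧ q ≤ k then 1 else 0 := by
      intro m hm h1 h2 h3 h4
      rw [← Finset.sum_filter]
      have h5 : (Finset.range n).filter (fun q => q ≤ i ∧ q ≤ j ∧ q ≤ k)
          = Finset.range (m + 1) := by
        ext q; simp; omega
      rw [h5]
      simp
    have hmul : ∀ X Y : H →L[ℂ] H, ‖X‖ ≤ 1 → ‖Y‖ ≤ 1 → ‖X * Y‖ ≤ 1 := fun X Y hX hY =>
      (norm_mul_le _ _).trans (mul_le_one₀ hX (norm_nonneg _) hY)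
    have h1 : ‖(1 : H →L[ℂ] H)‖ ≤ 1 := ContinuousLinearMap.norm_id_le
    by_cases hij : i ≤ j ∧ i ≤ k
    · have h := pairingSumLE_mul_diagonalOperator_mul hu (s i) h1
        (hmul _ _ (hmul _ _ (hmul _ _ hW (hD1 j)) hW') (hD1 k))
      refine PairingSumLE.mono ?_ ((hsum i hi).trans (hcount i hi (by simp) le_rfl hij.1 hij.2))
      simpa only [one_mul, mul_assoc] using h
    · by_cases hjk : j ≤ i ∧ j ≤ k
      · have h := pairingSumLE_mul_diagonalOperator_mul hu (s j) (hmul _ _ (hD1 i) hW)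
          (hmul _ _ hW' (hD1 k))
        refine PairingSumLE.mono ?_ ((hsum j hj).trans (hcount j hj (by simp) hjk.1 le_rfl hjk.2))
        simpa only [mul_assoc] using h
      · have h := pairingSumLE_mul_diagonalOperator_mul hu (s k)
          (hmul _ _ (hmul _ _ (hmul _ _ (hD1 i) hW) (hD1 j)) hW') h1
        refine PairingSumLE.mono ?_ ((hsum k hk).trans
          (hcount k hk (by simp) (by omega) (by omega) le_rfl))
        simpa only [mul_one, mul_assoc] using h
  have hexp : diagonalOperator u (fun k => (a k : ℂ)) * W * diagonalOperator u (fun k => (a k : ℂ))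
      * W' * diagonalOperator u (fun k => (a k : ℂ)) = ∑ i ∈ Finset.range n, ∑ j ∈ Finset.range n,
        ∑ k ∈ Finset.range n, ((δ i * δ j * δ k : ℝ) : ℂ) • (D i * W * D j * W' * D k) := by
    rw [hD, Finset.sum_mul, Finset.sum_mul_sum, Finset.sum_mul, Finset.sum_mul]
    refine Finset.sum_congr rfl fun i _ => ?_
    rw [Finset.sum_mul, Finset.sum_mul]
    refine Finset.sum_congr rfl fun j _ => ?_
    rw [Finset.mul_sum]
    refine Finset.sum_congr rfl fun k _ => ?_
    simp only [smul_mul_assoc, mul_smul_comm, smul_smul]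
    congr 1
    push_cast
    ring
  rw [hexp]
  refine (PairingSumLE.sum fun i hi => PairingSumLE.sum fun j hj => PairingSumLE.sum fun k hk =>
    (hrank i hi j hj k hk).smul (mul_nonneg (mul_nonneg (hδ i) (hδ j)) (hδ k))).mono (le_of_eq ?_)
  have hcube : ∑ k, |a k| ^ 3 = ∑ q ∈ Finset.range n, μ q ^ 3 := by
    rw [← Fin.sum_univ_eq_sum_range (fun q => μ q ^ 3) n]
    simp [μ]
  rw [hcube]
  have hq : ∀ q ∈ Finset.range n, μ q ^ 3 = ∑ i ∈ Finset.range n, ∑ j ∈ Finset.range n,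
      ∑ k ∈ Finset.range n, δ i * δ j * δ k * if q ≤ i ∧ q ≤ j ∧ q ≤ k then 1 else 0 := by
    intro q hq
    rw [← hμ q hq, pow_succ, pow_two, Finset.sum_mul_sum, Finset.sum_mul]
    refine Finset.sum_congr rfl fun i _ => ?_
    rw [Finset.sum_mul]
    refine Finset.sum_congr rfl fun j _ => ?_
    rw [Finset.mul_sum]
    refine Finset.sum_congr rfl fun k _ => ?_
    by_cases h1 : q ≤ i <;> by_cases h2 : q ≤ j <;> by_cases h3 : q ≤ k <;> simp [h1, h2, h3]
  rw [Finset.sum_congr rfl hq]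
  symm
  refine Finset.sum_comm.trans (Finset.sum_congr rfl fun i _ => ?_)
  refine Finset.sum_comm.trans (Finset.sum_congr rfl fun j _ => ?_)
  refine Finset.sum_comm.trans (Finset.sum_congr rfl fun k _ => ?_)
  rw [Finset.mul_sum]

/-- Hölder's inequality for a product of three copies of a self-adjoint operator interlaced with
contractions. -/
theorem PairingSumLE.triple (e : HilbertBasis ℕ ℂ H) {V : H →L[ℂ] H} (hV : IsSelfAdjoint V)
    {C : ℝ} (h : PairingSumLE 3 V C) {W W' : H →L[ℂ] H} (hW : ‖W‖ ≤ 1) (hW' : ‖W'‖ ≤ 1) :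
    PairingSumLE 1 (V * W * V * W' * V) C := by
  refine PairingSumLE.of_tendsto
    (T := fun m => compression e V m * W * compression e V m * W' * compression e V m)
    (fun m => ?_) fun x => ?_
  · obtain ⟨n, u, a, hu, huE, hsum, ha⟩ :=
      exists_orthonormal_eigenvectors_compression hV (basisSpan e m)
    let σ := Tuple.sort fun k => -|a k|
    have hσ : Antitone fun k => |a (σ k)| := fun j k hjk => by
      have := Tuple.monotone_sort (fun k => -|a k|) hjk
      simpa using this
    have huσ : Orthonormal ℂ (u ∘ σ) := hu.comp _ σ.injective
    have hdiag : compression e V m = diagonalOperator (u ∘ σ) fun k => (a (σ k) : ℂ) := by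
      ext x
      have h1 := hsum _ ((basisSpan e m).starProjection_apply_mem x)
      rw [diagonalOperator_apply]
      simp only [Function.comp_apply]
      rw [Equiv.sum_comp σ (fun k => ((a k : ℂ) * ⟪u k, x⟫) • u k)]
      simp only [compression, mul_apply_eq_comp]
      rw [h1]
      simp only [map_sum, map_smul, ha, smul_smul]
      refine Finset.sum_congr rfl fun k _ => ?_
      rw [← Submodule.inner_starProjection_left_eq_right,
        Submodule.starProjection_eq_self_iff.2 (huE k), mul_comm]
    rw [hdiag]
    refine (pairingSumLE_diagonalOperator_triple huσ _ hW hW' hσ).mono ?_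
    rw [Equiv.sum_comp σ (fun k => |a k| ^ 3)]
    refine le_trans (le_of_eq ?_) (h (Fin n) u u hu hu)
    refine Finset.sum_congr rfl fun k _ => ?_
    have h1 : ⟪u k, V (u k)⟫ = (a k : ℂ) := by
      nth_rewrite 1 [← Submodule.starProjection_eq_self_iff.2 (huE k)]
      rw [Submodule.inner_starProjection_left_eq_right, ha, inner_smul_right,
        inner_self_eq_norm_sq_to_K, hu.1 k]
      simp
    rw [h1, Complex.norm_real, Real.norm_eq_abs]
  · have hc := fun {x : ℕ → H} {x' : H} => tendsto_apply_of_bounded (norm_compression_le e V)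
      (tendsto_compression e V) (x := x) (x' := x')
    exact hc (((W.continuous.tendsto _).comp (hc ((W'.continuous.tendsto _).comp
      (tendsto_compression e V x)))))

/-! ### Schatten norms and unitary groups -/

theorem PairingSumLE.summable {p : ℕ} (hp : 1 ≤ p) {T : H →L[ℂ] H} {C : ℝ}
    (h : PairingSumLE p T C) (e : HilbertBasis ℕ ℂ H) :
    Summable fun n => (⟪e n, (absCLM T ^ p) (e n)⟫).re :=
  summable_of_sum_range_le (fun n => re_inner_absCLM_pow_nonneg T p (e n))
    (sum_inner_absCLM_pow_le e hp h)

theorem PairingSumLE.tsum_le {p : ℕ} (hp : 1 ≤ p) {T : H →L[ℂ] H} {C : ℝ}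
    (h : PairingSumLE p T C) (e : HilbertBasis ℕ ℂ H) :
    ∑' n, (⟪e n, (absCLM T ^ p) (e n)⟫).re ≤ C :=
  Real.tsum_le_of_sum_range_le (fun n => re_inner_absCLM_pow_nonneg T p (e n))
    (sum_inner_absCLM_pow_le e hp h)

theorem PairingSumLE.isTraceClass {T : H →L[ℂ] H} {C : ℝ} (h : PairingSumLE 1 T C)
    (e : HilbertBasis ℕ ℂ H) : IsTraceClass e T ∧ traceNorm e T ≤ C := by
  have h1 := h.summable le_rfl e
  have h2 := h.tsum_le le_rfl e
  rw [pow_one] at h1 h2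
  exact ⟨h1, h2⟩

theorem schatten3Norm_nonneg (e : HilbertBasis ℕ ℂ H) (T : H →L[ℂ] H) : 0 ≤ schatten3Norm e T :=
  Real.rpow_nonneg (tsum_nonneg fun n => re_inner_absCLM_pow_nonneg T 3 (e n)) _

theorem schatten3Norm_pow_three (e : HilbertBasis ℕ ℂ H) (T : H →L[ℂ] H) :
    schatten3Norm e T ^ 3 = ∑' n, (⟪e n, (absCLM T ^ 3) (e n)⟫).re :=
  Real.rpow_inv_natCast_pow (n := 3)
    (tsum_nonneg fun n => re_inner_absCLM_pow_nonneg T 3 (e n)) (by norm_num)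

theorem PairingSumLE.isSchatten3 {T : H →L[ℂ] H} {C : ℝ} (hC : 0 ≤ C)
    (h : PairingSumLE 3 T (C ^ 3)) (e : HilbertBasis ℕ ℂ H) :
    IsSchatten3 e T ∧ schatten3Norm e T ≤ C := by
  refine ⟨h.summable (by norm_num) e, le_of_pow_le_pow_left₀ three_ne_zero hC ?_⟩
  rw [schatten3Norm_pow_three]
  exact h.tsum_le (by norm_num) e

theorem norm_star_group_apply {T : ℝ → H →L[ℂ] H} (h0 : T 0 = 1)
    (hgrp : ∀ s t, T (s + t) = T s * T t) (hiso : ∀ t x, ‖T t x‖ = ‖x‖) (t : ℝ) (x : H) :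
    ‖star (T t) x‖ = ‖x‖ := by
  have h1 : star (T t) x = T (-t) x := by
    refine ext_inner_left ℂ fun y => ?_
    rw [ContinuousLinearMap.star_eq_adjoint, ContinuousLinearMap.adjoint_inner_right,
      inner_group_apply_left h0 hgrp hiso]
  rw [h1, hiso]

theorem opNorm_le_one_of_isometry {T : H →L[ℂ] H} (h : ∀ x, ‖T x‖ = ‖x‖) : ‖T‖ ≤ 1 :=
  T.opNorm_le_bound zero_le_one fun x => by rw [h, one_mul]


/-- **Schatten-norm estimates for the unitary groups (from the proof of Theorem 3.2).**
Let `A` be a (possibly unbounded) self-adjoint operator, `V` self-adjoint in `B₃(H)`,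
`A_τ = A + τV` with unitary groups `U τ t = e^{itA_τ}`.  Then
`‖e^{iνA_τ} − e^{iνA}‖₃ ≤ |ντ| ‖V‖₃` for all real `ν` and `τ ∈ [0,1]`; in particular, for
`0 ≤ ν ≤ β ≤ t`, `e^{iνA_τ} V e^{i(β−ν)A_τ} V e^{i(t−β)A_τ} − e^{iνA} V e^{i(β−ν)A} V e^{i(t−β)A}`
is trace class with trace norm at most `|τ| ‖V‖₃³ (|ν| + |β−ν| + |t−β|)`. -/
theorem schatten3_estimates_unitary_groups
    (e : HilbertBasis ℕ ℂ H)
    (A : H →ₗ.[ℂ] H) (hA : IsSelfAdjoint A)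
    (V : H →L[ℂ] H) (hV : IsSelfAdjoint V) (hV3 : IsSchatten3 e V)
    (U : ℝ → ℝ → H →L[ℂ] H)
    (hU0 : ∀ τ ∈ Set.Icc (0:ℝ) 1, U τ 0 = 1)
    (hUgrp : ∀ τ ∈ Set.Icc (0:ℝ) 1, ∀ s t : ℝ, U τ (s + t) = U τ s * U τ t)
    (hUiso : ∀ τ ∈ Set.Icc (0:ℝ) 1, ∀ (t : ℝ) (x : H), ‖U τ t x‖ = ‖x‖)
    (hUcont : ∀ τ ∈ Set.Icc (0:ℝ) 1, ∀ x : H, Continuous fun t : ℝ => U τ t x)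
    (hUgen : ∀ τ ∈ Set.Icc (0:ℝ) 1, ∀ (x : A.domain) (t : ℝ),
      HasDerivAt (fun s : ℝ => U τ s (x : H))
        (Complex.I • U τ t (A x + τ • V (x : H))) t) :
    (∀ τ ∈ Set.Icc (0:ℝ) 1, ∀ ν : ℝ,
      IsSchatten3 e (U τ ν - U 0 ν) ∧
      schatten3Norm e (U τ ν - U 0 ν) ≤ |ν * τ| * schatten3Norm e V) ∧
    (∀ τ ∈ Set.Icc (0:ℝ) 1, ∀ t β ν : ℝ, 0 ≤ ν → ν ≤ β → β ≤ t →
      IsTraceClass e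
        (U τ ν * V * U τ (β - ν) * V * U τ (t - β)
          - U 0 ν * V * U 0 (β - ν) * V * U 0 (t - β)) ∧
      traceNorm e
        (U τ ν * V * U τ (β - ν) * V * U τ (t - β)
          - U 0 ν * V * U 0 (β - ν) * V * U 0 (t - β))
        ≤ |τ| * schatten3Norm e V ^ 3 * (|ν| + |β - ν| + |t - β|)) := by
  have h0 : (0 : ℝ) ∈ Set.Icc (0 : ℝ) 1 := ⟨le_rfl, zero_le_one⟩
  set K := schatten3Norm e V with hKdef
  have hK : 0 ≤ K := schatten3Norm_nonneg e V
  have hVb : PairingSumLE 3 V (K ^ 3) := by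
    rw [hKdef, schatten3Norm_pow_three]
    exact hV3.pairingSumLE hV
  have hgen0 : ∀ (x : A.domain) (t : ℝ),
      HasDerivAt (fun s : ℝ => U 0 s (x : H)) (Complex.I • U 0 t (A x)) t := by
    intro x t
    simpa using hUgen 0 h0 x t
  have hstar : ∀ τ ∈ Set.Icc (0 : ℝ) 1, ∀ t x, ‖star (U τ t) x‖ = ‖x‖ := fun τ hτ =>
    norm_star_group_apply (hU0 τ hτ) (hUgrp τ hτ) (hUiso τ hτ)
  have hnorm : ∀ τ ∈ Set.Icc (0 : ℝ) 1, ∀ t, ‖U τ t‖ ≤ 1 := fun τ hτ t =>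
    opNorm_le_one_of_isometry (hUiso τ hτ t)
  have hduh : ∀ τ ∈ Set.Icc (0 : ℝ) 1, ∀ (ν : ℝ) {p : ℕ}, 1 ≤ p → ∀ {X Y : H →L[ℂ] H} {L : ℝ},
      0 ≤ L → (∀ s, PairingSumLE p (X * U τ s * V * U 0 (ν - s) * Y) (L ^ p)) →
      PairingSumLE p (X * (U τ ν - U 0 ν) * Y) ((|τ| * L * |ν|) ^ p) :=
    fun τ hτ ν p hp X Y L hL h => pairingSumLE_duhamel (hU0 τ hτ) (hUgrp τ hτ) (hUiso τ hτ)
      (hU0 0 h0) (hUgrp 0 h0) (hUiso 0 h0) hA hgen0 (hUgen τ hτ) ν hp hL h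
  refine ⟨fun τ hτ ν => ?_, fun τ hτ t β ν _ _ _ => ?_⟩
  · have h := hduh τ hτ ν (p := 3) (by norm_num) (X := 1) (Y := 1) hK fun s => by
      simpa using hVb.mul_isometries (hstar τ hτ s) (hUiso 0 h0 (ν - s))
    rw [one_mul, mul_one] at h
    have h' : |τ| * K * |ν| = |ν * τ| * K := by rw [abs_mul]; ring
    rw [h'] at h
    exact h.isSchatten3 (by positivity) e
  · have hmul : ∀ X Y : H →L[ℂ] H, ‖X‖ ≤ 1 → ‖Y‖ ≤ 1 → ‖X * Y‖ ≤ 1 := fun X Y hX hY =>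
      (norm_mul_le _ _).trans (mul_le_one₀ hX (norm_nonneg _) hY)
    have hK3 : 0 ≤ K ^ 3 := by positivity
    have h1 := hduh τ hτ ν le_rfl (X := 1) (Y := V * U τ (β - ν) * V * U τ (t - β)) hK3
      fun s => by
        have := (hVb.triple e hV (hnorm 0 h0 (ν - s)) (hnorm τ hτ (β - ν))).mul_isometries
          (hstar τ hτ s) (hUiso τ hτ (t - β))
        simpa only [one_mul, pow_one, mul_assoc] using this
    have h2 := hduh τ hτ (β - ν) le_rfl (X := U 0 ν * V) (Y := V * U τ (t - β)) hK3
      fun s => by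
        have := (hVb.triple e hV (hnorm τ hτ s) (hnorm 0 h0 (β - ν - s))).mul_isometries
          (hstar 0 h0 ν) (hUiso τ hτ (t - β))
        simpa only [pow_one, mul_assoc] using this
    have h3 := hduh τ hτ (t - β) le_rfl (X := U 0 ν * V * U 0 (β - ν) * V) (Y := 1) hK3
      fun s => by
        have := (hVb.triple e hV (hnorm 0 h0 (β - ν)) (hnorm τ hτ s)).mul_isometries
          (hstar 0 h0 ν) (hUiso 0 h0 (t - β - s))
        simpa only [mul_one, pow_one, mul_assoc] using this
    rw [pow_one] at h1 h2 h3
    have hsum := ((h1.add h2).add h3).isTraceClass e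
    have hop : 1 * (U τ ν - U 0 ν) * (V * U τ (β - ν) * V * U τ (t - β)) +
        U 0 ν * V * (U τ (β - ν) - U 0 (β - ν)) * (V * U τ (t - β)) +
        U 0 ν * V * U 0 (β - ν) * V * (U τ (t - β) - U 0 (t - β)) * 1 =
        U τ ν * V * U τ (β - ν) * V * U τ (t - β) - U 0 ν * V * U 0 (β - ν) * V * U 0 (t - β) := by
      noncomm_ring
    rw [hop] at hsum
    refine ⟨hsum.1, hsum.2.trans (le_of_eq ?_)⟩
    ring
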